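/- Let a ∈ ℝ and let α ∈ ℕ₀² be a multi-index. Then there exist real constants c_{α,β,ℓ}, indexed by multi-indices β ∈ ℕ₀² with |β| ≤ |α| and integers 0 ≤ ℓ ≤ |β|, such that for every smooth function u : 𝒟 → ℂ, writing v(z, φ) = e^{a z} u(e^{z} cos φ, e^{z} sin φ), one has for all (z, φ) ∈ ℝ × (0, κ): ∂_z^{α₁} ∂_φ^{α₂} v(z, φ) = e^{a z} · Σ_{|β| ≤ |α|} Σ_{ℓ=0}^{|β|} c_{α,β,ℓ} · (e^{z} cos φ)^{ℓ} (e^{z} sin φ)^{|β|−ℓ} · (∂^β u)(e^{z} cos φ, e^{z} sin φ). -/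

import Mathlib

open MeasureTheory Set Real
open scoped ENNReal

noncomputable section

/-- The planar angular domain with opening angle `κ`, as a subset of `ℝ × ℝ`. -/
def D2 (κ : ℝ) : Set (ℝ × ℝ) :=
  {x | ∃ r φ : ℝ, 0 < r ∧ 0 < φ ∧ φ < κ ∧ x = (r * Real.cos φ, r * Real.sin φ)}

/-- Partial derivative in the first variable. -/
def pd1 (f : ℝ × ℝ → ℂ) : ℝ × ℝ → ℂ := fun x => deriv (fun s => f (s, x.2)) x.1

/-- Partial derivative in the second variable. -/
def pd2 (f : ℝ × ℝ → ℂ) : ℝ × ℝ → ℂ := fun x => deriv (fun s => f (x.1, s)) x.2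

/-- Iterated partial derivative `∂_{x₁}^{α₁} ∂_{x₂}^{α₂} f` for a multi-index `α`. -/
def pdMix (α : ℕ × ℕ) (f : ℝ × ℝ → ℂ) : ℝ × ℝ → ℂ := pd1^[α.1] (pd2^[α.2] f)

/-- The Euler-coordinate parametrization `(z, φ) ↦ (eᶻ cos φ, eᶻ sin φ)`. -/
def eulerMap (p : ℝ × ℝ) : ℝ × ℝ := (Real.exp p.1 * Real.cos p.2, Real.exp p.1 * Real.sin p.2)

/-- The strip `ℝ × (0, κ)`. -/
def strip (κ : ℝ) : Set (ℝ × ℝ) := {p | 0 < p.2 ∧ p.2 < κ}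

/-- `v(z,φ) = e^{az} u(eᶻ cos φ, eᶻ sin φ)`. -/
def eulerPull (a : ℝ) (u : ℝ × ℝ → ℂ) : ℝ × ℝ → ℂ :=
  fun p => (Real.exp (a * p.1) : ℂ) * u (eulerMap p)

lemma D2_eq (κ : ℝ) : D2 κ = eulerMap '' strip κ := by
  ext x
  constructor
  · rintro ⟨r, φ, hr, h1, h2, rfl⟩
    exact ⟨(Real.log r, φ), ⟨h1, h2⟩, by simp [eulerMap, Real.exp_log hr]⟩
  · rintro ⟨p, ⟨h1, h2⟩, rfl⟩
    exact ⟨Real.exp p.1, p.2, Real.exp_pos _, h1, h2, rfl⟩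

lemma strip_open (κ : ℝ) : IsOpen (strip κ) :=
  (isOpen_lt continuous_const continuous_snd).inter (isOpen_lt continuous_snd continuous_const)

lemma eulerMap_open : IsOpenMap eulerMap := by
  have h1 : IsOpenMap Complex.exp := by
    apply IsOpenMap.of_nhds_le
    intro z
    exact ((Complex.hasStrictDerivAt_exp z).map_nhds_eq (Complex.exp_ne_zero z)).ge
  have h2 : eulerMap = Complex.equivRealProdCLM ∘ Complex.exp ∘ Complex.equivRealProdCLM.symm := by
    funext p
    ext
    · change _ = (Complex.exp ⟨p.1, p.2⟩).re
      simp [eulerMap, Complex.exp_re]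
    · change _ = (Complex.exp ⟨p.1, p.2⟩).im
      simp [eulerMap, Complex.exp_im]
  rw [h2]
  exact (Complex.equivRealProdCLM.toHomeomorph.isOpenMap).comp
    (h1.comp Complex.equivRealProdCLM.symm.toHomeomorph.isOpenMap)

lemma D2_open (κ : ℝ) : IsOpen (D2 κ) := by
  rw [D2_eq]; exact eulerMap_open _ (strip_open κ)

def Sm (D : Set (ℝ × ℝ)) (w : ℝ × ℝ → ℂ) : Prop := ContDiffOn ℝ (⊤ : ℕ∞) w D

lemma Sm.diffAt {D : Set (ℝ × ℝ)} (hD : IsOpen D) {w : ℝ × ℝ → ℂ} (h : Sm D w)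
    {x : ℝ × ℝ} (hx : x ∈ D) : DifferentiableAt ℝ w x :=
  (h.contDiffAt (hD.mem_nhds hx)).differentiableAt (by simp)

lemma pd1_eq {w : ℝ × ℝ → ℂ} {x : ℝ × ℝ} (h : DifferentiableAt ℝ w x) :
    pd1 w x = fderiv ℝ w x (1, 0) := by
  have h2 : HasDerivAt (fun s : ℝ => (s, x.2)) ((1 : ℝ), (0 : ℝ)) x.1 :=
    (hasDerivAt_id _).prodMk (hasDerivAt_const _ _)
  exact (HasFDerivAt.comp_hasDerivAt x.1 (f := fun s : ℝ => (s, x.2)) h.hasFDerivAt h2).deriv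

lemma pd2_eq {w : ℝ × ℝ → ℂ} {x : ℝ × ℝ} (h : DifferentiableAt ℝ w x) :
    pd2 w x = fderiv ℝ w x (0, 1) := by
  have h2 : HasDerivAt (fun s : ℝ => (x.1, s)) ((0 : ℝ), (1 : ℝ)) x.2 :=
    (hasDerivAt_const _ _).prodMk (hasDerivAt_id _)
  exact (HasFDerivAt.comp_hasDerivAt x.2 (f := fun s : ℝ => (x.1, s)) h.hasFDerivAt h2).deriv

lemma Sm.fd {D : Set (ℝ × ℝ)} (hD : IsOpen D) {w : ℝ × ℝ → ℂ} (h : Sm D w) (e : ℝ × ℝ) :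
    Sm D (fun x => fderiv ℝ w x e) := by
  have : ContDiffOn ℝ (⊤ : ℕ∞) (fderiv ℝ w) D := ContDiffOn.fderiv_of_isOpen h hD (by simp)
  exact this.clm_apply contDiffOn_const

lemma Sm.pd1 {D : Set (ℝ × ℝ)} (hD : IsOpen D) {w : ℝ × ℝ → ℂ} (h : Sm D w) :
    Sm D (pd1 w) :=
  ContDiffOn.congr (h.fd hD (1, 0)) fun _ hx => pd1_eq (h.diffAt hD hx)

lemma Sm.pd2 {D : Set (ℝ × ℝ)} (hD : IsOpen D) {w : ℝ × ℝ → ℂ} (h : Sm D w) :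
    Sm D (pd2 w) :=
  ContDiffOn.congr (h.fd hD (0, 1)) fun _ hx => pd2_eq (h.diffAt hD hx)

lemma pd1_congr {D : Set (ℝ × ℝ)} (hD : IsOpen D) {f g : ℝ × ℝ → ℂ} (h : EqOn f g D) :
    EqOn (pd1 f) (pd1 g) D := by
  intro x hx
  apply Filter.EventuallyEq.deriv_eq
  have hc : Continuous (fun s : ℝ => (s, x.2)) := by fun_prop
  filter_upwards [hc.continuousAt.preimage_mem_nhds (hD.mem_nhds hx)] with s hs using h hs

lemma pd2_congr {D : Set (ℝ × ℝ)} (hD : IsOpen D) {f g : ℝ × ℝ → ℂ} (h : EqOn f g D) :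
    EqOn (pd2 f) (pd2 g) D := by
  intro x hx
  apply Filter.EventuallyEq.deriv_eq
  have hc : Continuous (fun s : ℝ => (x.1, s)) := by fun_prop
  filter_upwards [hc.continuousAt.preimage_mem_nhds (hD.mem_nhds hx)] with s hs using h hs

lemma schwarz {D : Set (ℝ × ℝ)} (hD : IsOpen D) {w : ℝ × ℝ → ℂ} (h : Sm D w) :
    EqOn (pd1 (pd2 w)) (pd2 (pd1 w)) D := by
  intro x hx
  have hs : IsSymmSndFDerivAt ℝ w x :=
    (h.contDiffAt (hD.mem_nhds hx)).isSymmSndFDerivAt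
      (by rw [minSmoothness_of_isRCLikeNormedField]; exact WithTop.coe_le_coe.2 le_top)
  have hd : DifferentiableAt ℝ (fderiv ℝ w) x := by
    have : ContDiffOn ℝ (⊤ : ℕ∞) (fderiv ℝ w) D := ContDiffOn.fderiv_of_isOpen h hD (by simp)
    exact (this.contDiffAt (hD.mem_nhds hx)).differentiableAt (by simp)
  rw [pd1_congr hD (g := fun x => fderiv ℝ w x (0, 1)) (fun y hy => pd2_eq (h.diffAt hD hy)) hx,
    pd2_congr hD (g := fun x => fderiv ℝ w x (1, 0)) (fun y hy => pd1_eq (h.diffAt hD hy)) hx,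
    pd1_eq ((h.fd hD _).diffAt hD hx), pd2_eq ((h.fd hD _).diffAt hD hx)]
  rw [fderiv_clm_apply hd (by fun_prop), fderiv_clm_apply hd (by fun_prop)]
  simpa using hs (1, 0) (0, 1)

lemma Sm.it1 {D : Set (ℝ × ℝ)} (hD : IsOpen D) {w : ℝ × ℝ → ℂ} (h : Sm D w) (n : ℕ) :
    Sm D (_root_.pd1^[n] w) := by
  induction n with
  | zero => exact h
  | succ n ih => rw [Function.iterate_succ_apply']; exact ih.pd1 hD

lemma Sm.it2 {D : Set (ℝ × ℝ)} (hD : IsOpen D) {w : ℝ × ℝ → ℂ} (h : Sm D w) (n : ℕ) :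
    Sm D (_root_.pd2^[n] w) := by
  induction n with
  | zero => exact h
  | succ n ih => rw [Function.iterate_succ_apply']; exact ih.pd2 hD

lemma Sm.mix {D : Set (ℝ × ℝ)} (hD : IsOpen D) {w : ℝ × ℝ → ℂ} (h : Sm D w) (β : ℕ × ℕ) :
    Sm D (pdMix β w) := (h.it2 hD _).it1 hD _

lemma pd2_it1 {D : Set (ℝ × ℝ)} (hD : IsOpen D) {w : ℝ × ℝ → ℂ} (h : Sm D w) (n : ℕ) :
    EqOn (pd1^[n] (pd2 w)) (pd2 (pd1^[n] w)) D := by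
  induction n with
  | zero => exact fun _ _ => rfl
  | succ n ih =>
    rw [Function.iterate_succ_apply', Function.iterate_succ_apply']
    exact (pd1_congr hD ih).trans (schwarz hD (h.it1 hD n))

lemma mix1 (β : ℕ × ℕ) (w : ℝ × ℝ → ℂ) : pdMix (β.1 + 1, β.2) w = pd1 (pdMix β w) := by
  simp only [pdMix, Function.iterate_succ_apply']

lemma mix2 {D : Set (ℝ × ℝ)} (hD : IsOpen D) {w : ℝ × ℝ → ℂ} (h : Sm D w) (β : ℕ × ℕ) :
    EqOn (pdMix (β.1, β.2 + 1) w) (pd2 (pdMix β w)) D := by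
  simp only [pdMix, Function.iterate_succ_apply']
  exact pd2_it1 hD (h.it2 hD _) _

lemma hasDeriv_curve {w : ℝ × ℝ → ℂ} {X Y : ℝ → ℝ} {X' Y' t : ℝ}
    (hw : DifferentiableAt ℝ w (X t, Y t))
    (hX : HasDerivAt X X' t) (hY : HasDerivAt Y Y' t) :
    HasDerivAt (fun s => w (X s, Y s)) (X' * pd1 w (X t, Y t) + Y' * pd2 w (X t, Y t)) t := by
  have := HasFDerivAt.comp_hasDerivAt t (f := fun s => (X s, Y s)) hw.hasFDerivAt (hX.prodMk hY)
  refine this.congr_deriv ?_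
  rw [pd1_eq hw, pd2_eq hw]
  have : ((X', Y') : ℝ × ℝ) = X' • (1, 0) + Y' • (0, 1) := by simp
  rw [this, map_add, map_smul, map_smul]
  simp

/-- monomials -/
def Mo (a : ℝ) (β : ℕ × ℕ) (l m : ℕ) : (ℝ × ℝ → ℂ) → ℝ × ℝ → ℂ := fun u p =>
  (Real.exp (a * p.1) : ℂ) * (((Real.exp p.1 * Real.cos p.2 : ℝ) : ℂ) ^ l *
    ((Real.exp p.1 * Real.sin p.2 : ℝ) : ℂ) ^ m * pdMix β u (eulerMap p))

def Sp (a : ℝ) (n : ℕ) : Submodule ℝ ((ℝ × ℝ → ℂ) → ℝ × ℝ → ℂ) :=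
  Submodule.span ℝ {F | ∃ β l m, l + m = β.1 + β.2 ∧ β.1 + β.2 ≤ n ∧ F = Mo a β l m}

lemma Mo_mem (a : ℝ) (n : ℕ) (β : ℕ × ℕ) (l m : ℕ) (h : l + m = β.1 + β.2)
    (h' : β.1 + β.2 ≤ n) : Mo a β l m ∈ Sp a n :=
  Submodule.subset_span ⟨β, l, m, h, h', rfl⟩

lemma Mo_d1 (a : ℝ) {D : Set (ℝ × ℝ)} (hD : IsOpen D) (β : ℕ × ℕ) (l m : ℕ)
    {u : ℝ × ℝ → ℂ} (hu : Sm D u) {p : ℝ × ℝ} (hp : eulerMap p ∈ D) :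
    HasDerivAt (fun s => Mo a β l m u (s, p.2))
      (((a + l + m) • Mo a β l m + Mo a (β.1 + 1, β.2) (l + 1) m
        + Mo a (β.1, β.2 + 1) l (m + 1)) u p) p.1 := by
  obtain ⟨z, φ⟩ := p
  have hX : HasDerivAt (fun s => Real.exp s * Real.cos φ) (Real.exp z * Real.cos φ) z :=
    (Real.hasDerivAt_exp z).mul_const _
  have hY : HasDerivAt (fun s => Real.exp s * Real.sin φ) (Real.exp z * Real.sin φ) z :=
    (Real.hasDerivAt_exp z).mul_const _
  have hE : HasDerivAt (fun s => Real.exp (a * s)) (Real.exp (a * z) * a) z := by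
    simpa using ((hasDerivAt_id z).const_mul a).exp
  have hW := hasDeriv_curve (w := pdMix β u) ((hu.mix hD β).diffAt hD hp) hX hY
  have := hE.ofReal_comp.mul (((hX.ofReal_comp.pow l).mul (hY.ofReal_comp.pow m)).mul hW)
  refine this.congr_deriv ?_
  simp only [Mo, Pi.add_apply, Pi.smul_apply, mix2 hD hu β hp, mix1]
  simp only [eulerMap, Complex.real_smul]
  rcases l with _ | l <;> rcases m with _ | m <;> simp <;> ring

lemma Mo_d2 (a : ℝ) {D : Set (ℝ × ℝ)} (hD : IsOpen D) (β : ℕ × ℕ) (l m : ℕ)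
    {u : ℝ × ℝ → ℂ} (hu : Sm D u) {p : ℝ × ℝ} (hp : eulerMap p ∈ D) :
    HasDerivAt (fun s => Mo a β l m u (p.1, s))
      (((-l : ℝ) • Mo a β (l - 1) (m + 1) + (m : ℝ) • Mo a β (l + 1) (m - 1)
        + (-1 : ℝ) • Mo a (β.1 + 1, β.2) l (m + 1)
        + Mo a (β.1, β.2 + 1) (l + 1) m) u p) p.2 := by
  obtain ⟨z, φ⟩ := p
  have hX : HasDerivAt (fun s => Real.exp z * Real.cos s) (Real.exp z * -Real.sin φ) φ :=
    (Real.hasDerivAt_cos φ).const_mul _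
  have hY : HasDerivAt (fun s => Real.exp z * Real.sin s) (Real.exp z * Real.cos φ) φ :=
    (Real.hasDerivAt_sin φ).const_mul _
  have hW := hasDeriv_curve (w := pdMix β u) ((hu.mix hD β).diffAt hD hp) hX hY
  have := (((hX.ofReal_comp.pow l).mul (hY.ofReal_comp.pow m)).mul hW).const_mul
    (Real.exp (a * z) : ℂ)
  refine this.congr_deriv ?_
  simp only [Mo, Pi.add_apply, Pi.smul_apply, mix2 hD hu β hp, mix1]
  simp only [eulerMap, Complex.real_smul]
  rcases l with _ | l <;> rcases m with _ | m <;> simp <;> ring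

lemma Sp_deriv (a κ : ℝ) (n : ℕ) {F : (ℝ × ℝ → ℂ) → ℝ × ℝ → ℂ} (hF : F ∈ Sp a n) :
    ∃ G ∈ Sp a (n + 1), ∃ H ∈ Sp a (n + 1), ∀ u, Sm (D2 κ) u → ∀ p ∈ strip κ,
      HasDerivAt (fun s => F u (s, p.2)) (G u p) p.1 ∧
      HasDerivAt (fun s => F u (p.1, s)) (H u p) p.2 := by
  induction hF using Submodule.span_induction with
  | zero => exact ⟨0, zero_mem _, 0, zero_mem _, fun u _ p _ =>
      ⟨hasDerivAt_const _ _, hasDerivAt_const _ _⟩⟩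
  | add F F' _ _ h h' =>
    obtain ⟨G, hG, H, hH, h⟩ := h
    obtain ⟨G', hG', H', hH', h'⟩ := h'
    exact ⟨G + G', add_mem hG hG', H + H', add_mem hH hH', fun u hu p hp =>
      ⟨(h u hu p hp).1.add (h' u hu p hp).1, (h u hu p hp).2.add (h' u hu p hp).2⟩⟩
  | smul c F _ h =>
    obtain ⟨G, hG, H, hH, h⟩ := h
    exact ⟨c • G, Submodule.smul_mem _ _ hG, c • H, Submodule.smul_mem _ _ hH, fun u hu p hp =>
      ⟨(h u hu p hp).1.const_smul c, (h u hu p hp).2.const_smul c⟩⟩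
  | mem F hF =>
    obtain ⟨β, l, m, h1, h2, rfl⟩ := hF
    have hm : ∀ p ∈ strip κ, eulerMap p ∈ D2 κ := fun p hp => by
      rw [D2_eq]; exact ⟨p, hp, rfl⟩
    refine ⟨_, ?_, _, ?_, fun u hu p hp => ⟨Mo_d1 a (D2_open κ) β l m hu (hm p hp),
      Mo_d2 a (D2_open κ) β l m hu (hm p hp)⟩⟩
    · refine add_mem (add_mem (Submodule.smul_mem _ _ ?_) ?_) ?_ <;>
        apply Mo_mem <;> (try simp only) <;> omega
    · refine add_mem (add_mem (add_mem ?_ ?_) (Submodule.smul_mem _ _ ?_)) ?_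
      · rcases l with _ | l
        · simp
        · apply Submodule.smul_mem
          apply Mo_mem <;> (try simp only) <;> omega
      · rcases m with _ | m
        · simp
        · apply Submodule.smul_mem
          apply Mo_mem <;> (try simp only) <;> omega
      · apply Mo_mem <;> (try simp only) <;> omega
      · apply Mo_mem <;> (try simp only) <;> omega

lemma it2_mem (a κ : ℝ) (k : ℕ) : ∃ F ∈ Sp a k, ∀ u, Sm (D2 κ) u →
    EqOn (pd2^[k] (eulerPull a u)) (F u) (strip κ) := by
  induction k with
  | zero =>
    refine ⟨_, Mo_mem a 0 (0, 0) 0 0 rfl le_rfl, fun u _ p _ => ?_⟩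
    simp [Mo, eulerPull, pdMix]
  | succ k ih =>
    obtain ⟨F, hF, h⟩ := ih
    obtain ⟨G, hG, H, hH, h'⟩ := Sp_deriv a κ k hF
    refine ⟨H, hH, fun u hu p hp => ?_⟩
    rw [Function.iterate_succ_apply', pd2_congr (strip_open κ) (h u hu) hp]
    exact (h' u hu p hp).2.deriv

lemma mix_mem (a κ : ℝ) (j k : ℕ) : ∃ F ∈ Sp a (j + k), ∀ u, Sm (D2 κ) u →
    EqOn (pd1^[j] (pd2^[k] (eulerPull a u))) (F u) (strip κ) := by
  induction j with
  | zero => rw [zero_add]; exact it2_mem a κ k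
  | succ j ih =>
    obtain ⟨F, hF, h⟩ := ih
    obtain ⟨G, hG, H, hH, h'⟩ := Sp_deriv a κ _ hF
    refine ⟨G, by rwa [add_right_comm], fun u hu p hp => ?_⟩
    rw [Function.iterate_succ_apply', pd1_congr (strip_open κ) (h u hu) hp]
    exact (h' u hu p hp).1.deriv

lemma Sp_sum (a : ℝ) (n : ℕ) {F : (ℝ × ℝ → ℂ) → ℝ × ℝ → ℂ} (hF : F ∈ Sp a n) :
    ∃ c : ℕ × ℕ → ℕ → ℝ, ∀ u p, F u p =
      ∑ β ∈ Finset.filter (fun β : ℕ × ℕ => β.1 + β.2 ≤ n)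
                (Finset.range (n + 1) ×ˢ Finset.range (n + 1)),
              ∑ l ∈ Finset.range (β.1 + β.2 + 1), (c β l : ℂ) * Mo a β l (β.1 + β.2 - l) u p := by
  induction hF using Submodule.span_induction with
  | zero => exact ⟨0, by simp⟩
  | add F F' _ _ h h' =>
    obtain ⟨c, h⟩ := h
    obtain ⟨c', h'⟩ := h'
    refine ⟨c + c', fun u p => ?_⟩
    simp only [Pi.add_apply, h, h', Complex.ofReal_add, add_mul, Finset.sum_add_distrib]
  | smul r F _ h =>
    obtain ⟨c, h⟩ := h
    refine ⟨r • c, fun u p => ?_⟩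
    simp only [Pi.smul_apply, h, smul_eq_mul, Complex.real_smul, Complex.ofReal_mul, mul_assoc,
      Finset.mul_sum]
  | mem F hF =>
    obtain ⟨β, l, m, h1, h2, rfl⟩ := hF
    refine ⟨fun β' l' => if β' = β then (if l' = l then 1 else 0) else 0, fun u p => ?_⟩
    rw [Finset.sum_eq_single β, Finset.sum_eq_single l]
    · simp [← h1]
    · intro l' _ hl; simp [hl]
    · intro hl; exact absurd (Finset.mem_range.2 (by omega)) hl
    · intro β' _ hb; simp [hb]
    · intro hb
      exact absurd (by simp only [Finset.mem_filter, Finset.mem_product, Finset.mem_range]; omega) hb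

theorem stmt11 (κ : ℝ) (hκ : 0 < κ) (hκ' : κ < 2 * π) (a : ℝ) (α : ℕ × ℕ) :
    ∃ c : ℕ × ℕ → ℕ → ℝ,
      ∀ u : ℝ × ℝ → ℂ, ContDiffOn ℝ (⊤ : ℕ∞) u (D2 κ) → ∀ p ∈ strip κ,
        pdMix α (eulerPull a u) p =
          (Real.exp (a * p.1) : ℂ) *
            ∑ β ∈ Finset.filter (fun β : ℕ × ℕ => β.1 + β.2 ≤ α.1 + α.2)
                (Finset.range (α.1 + α.2 + 1) ×ˢ Finset.range (α.1 + α.2 + 1)),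
              ∑ l ∈ Finset.range (β.1 + β.2 + 1),
                (c β l : ℂ) * ((Real.exp p.1 * Real.cos p.2 : ℝ) : ℂ) ^ l *
                  ((Real.exp p.1 * Real.sin p.2 : ℝ) : ℂ) ^ (β.1 + β.2 - l) *
                  pdMix β u (eulerMap p) := by
  obtain ⟨F, hF, h⟩ := mix_mem a κ α.1 α.2
  obtain ⟨c, hc⟩ := Sp_sum a _ hF
  refine ⟨c, fun u hu p hp => ?_⟩
  rw [pdMix, h u hu hp, hc, Finset.mul_sum]
  refine Finset.sum_congr rfl fun β _ => ?_
  rw [Finset.mul_sum]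
  refine Finset.sum_congr rfl fun l _ => ?_
  rw [Mo]
  ring
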